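/- Let d ≥ 1, let I₁, I₂ ⊂ ℝ^d be relatively separated sets, let s > d and δ ∈ (0,1], and let 𝒜₁ = 𝒥_s(I₁) be a Jaffard algebra and 𝒜₂ = 𝒮¹_δ(I₂) a weighted Schur algebra. Then the mixed tensor algebra 𝒜 = Ã₁ ∩ Ã₂ is inverse-closed: if A ∈ 𝒜 acts as a boundedly invertible operator on ℓ²(I₁×I₂), then the rank-four tensor whose entry B_{i,k,n,m} equals the ((i,k),(m,n)) matrix entry of A⁻¹ also belongs to 𝒜. -/

import Mathlib

open scoped ComplexConjugate

noncomputable section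

namespace PaperTensor

variable {I I₁ I₂ : Type*}

/-- The space `ℓ²(I)`. -/
abbrev L2 (I : Type*) := lp (fun _ : I => ℂ) 2

/-- The continuous linear map `T` represents the matrix `M` as an operator on `ℓ²(I)`,
i.e. `(T c) k = Σ_l M k l * c l` for every `c ∈ ℓ²(I)`. -/
def Represents (M : I → I → ℂ) (T : L2 I →L[ℂ] L2 I) : Prop :=
  ∀ c : L2 I, ∀ k : I, HasSum (fun l : I => M k l * (c : ∀ _ : I, ℂ) l) ((T c : ∀ _ : I, ℂ) k)

/-- `M` defines a bounded operator on `ℓ²(I)`. -/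
def Bounded2 (M : I → I → ℂ) : Prop := ∃ T : L2 I →L[ℂ] L2 I, Represents M T

/-- The operator norm `‖M‖_{B(ℓ²(I))}` of the matrix `M` (junk value `0` if `M` is unbounded). -/
noncomputable def opNorm2 (M : I → I → ℂ) : ℝ :=
  letI : Decidable (Bounded2 M) := Classical.propDecidable _
  if h : Bounded2 M then ‖h.choose‖ else 0

/-- The matrix product of two infinite matrices. -/
noncomputable def matMul (A B : I → I → ℂ) : I → I → ℂ :=
  fun i j => ∑' m : I, A i m * B m j

/-- The conjugate transpose of a matrix. -/
def conjTranspose (A : I → I → ℂ) : I → I → ℂ := fun i j => conj (A j i)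

/-- A solid Banach algebra of (infinite) matrices over the index set `I`. -/
structure SolidBanachAlgebra (I : Type*) where
  carrier : Set (I → I → ℂ)
  anorm : (I → I → ℂ) → ℝ
  zero_mem : (0 : I → I → ℂ) ∈ carrier
  add_mem : ∀ A B : I → I → ℂ, A ∈ carrier → B ∈ carrier → A + B ∈ carrier
  smul_mem : ∀ (c : ℂ) (A : I → I → ℂ), A ∈ carrier → c • A ∈ carrier
  mul_mem : ∀ A B : I → I → ℂ, A ∈ carrier → B ∈ carrier → matMul A B ∈ carrier
  anorm_nonneg : ∀ A ∈ carrier, 0 ≤ anorm A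
  anorm_zero : anorm 0 = 0
  anorm_eq_zero : ∀ A ∈ carrier, anorm A = 0 → A = 0
  anorm_smul : ∀ (c : ℂ), ∀ A ∈ carrier, anorm (c • A) = ‖c‖ * anorm A
  anorm_add : ∀ A ∈ carrier, ∀ B ∈ carrier, anorm (A + B) ≤ anorm A + anorm B
  anorm_mul : ∀ A ∈ carrier, ∀ B ∈ carrier, anorm (matMul A B) ≤ anorm A * anorm B
  complete : ∀ f : ℕ → (I → I → ℂ), (∀ n, f n ∈ carrier) →
      (∀ ε > (0 : ℝ), ∃ N : ℕ, ∀ m ≥ N, ∀ n ≥ N, anorm (f m - f n) < ε) →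
      ∃ A ∈ carrier, ∀ ε > (0 : ℝ), ∃ N : ℕ, ∀ n ≥ N, anorm (f n - A) < ε
  bounded : ∀ A ∈ carrier, Bounded2 A
  solid : ∀ A ∈ carrier, ∀ B : I → I → ℂ,
      (∀ i j, ‖B i j‖ ≤ ‖A i j‖) → B ∈ carrier ∧ anorm B ≤ anorm A

/-- A matrix algebra is involutive if it is closed under conjugate transposition and the
norm is invariant under it. -/
def SolidBanachAlgebra.Involutive (𝒜 : SolidBanachAlgebra I) : Prop :=
  ∀ A ∈ 𝒜.carrier, conjTranspose A ∈ 𝒜.carrier ∧ 𝒜.anorm (conjTranspose A) = 𝒜.anorm A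

/-- Rank-four tensors `(A_{i,k,l,j})` indexed by `I₁ × I₂² × I₁`. -/
abbrev Tensor (I₁ I₂ : Type*) := I₁ → I₂ → I₂ → I₁ → ℂ

/-- The restriction `A|_{{i} × I₂² × {j}}`, an `I₂ × I₂` matrix. -/
def res1 (A : Tensor I₁ I₂) (i j : I₁) : I₂ → I₂ → ℂ := fun k l => A i k l j

/-- The restriction `A|_{I₁ × {(k,l)} × I₁}`, an `I₁ × I₁` matrix. -/
def res2 (A : Tensor I₁ I₂) (k l : I₂) : I₁ → I₁ → ℂ := fun i j => A i k l j

/-- Membership in `Ã₁`, for a set `S` of `I₁ × I₁` matrices playing the role of `𝒜₁`: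
all restrictions `A|_{{i} × I₂² × {j}}` are bounded on `ℓ²(I₂)` and the matrix of their
operator norms belongs to `S`. -/
def MemT1 (S : Set (I₁ → I₁ → ℂ)) (A : Tensor I₁ I₂) : Prop :=
  (∀ i j : I₁, Bounded2 (res1 A i j)) ∧
    (fun i j : I₁ => (opNorm2 (res1 A i j) : ℂ)) ∈ S

/-- Membership in `Ã₂`. -/
def MemT2 (S : Set (I₂ → I₂ → ℂ)) (A : Tensor I₁ I₂) : Prop :=
  (∀ k l : I₂, Bounded2 (res2 A k l)) ∧
    (fun k l : I₂ => (opNorm2 (res2 A k l) : ℂ)) ∈ S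

/-- The norm `‖A‖_{Ã₁}` (meaningful on members of `Ã₁`). -/
noncomputable def normT1 (𝒜₁ : SolidBanachAlgebra I₁) (A : Tensor I₁ I₂) : ℝ :=
  𝒜₁.anorm (fun i j : I₁ => (opNorm2 (res1 A i j) : ℂ))

/-- The norm `‖A‖_{Ã₂}` (meaningful on members of `Ã₂`). -/
noncomputable def normT2 (𝒜₂ : SolidBanachAlgebra I₂) (A : Tensor I₁ I₂) : ℝ :=
  𝒜₂.anorm (fun k l : I₂ => (opNorm2 (res2 A k l) : ℂ))

/-- Membership in `𝒜 = Ã₁ ∩ Ã₂`. -/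
def MemA (𝒜₁ : SolidBanachAlgebra I₁) (𝒜₂ : SolidBanachAlgebra I₂) (A : Tensor I₁ I₂) : Prop :=
  MemT1 𝒜₁.carrier A ∧ MemT2 𝒜₂.carrier A

/-- The norm `‖A‖_𝒜 = max {‖A‖_{Ã₁}, ‖A‖_{Ã₂}}`. -/
noncomputable def normA (𝒜₁ : SolidBanachAlgebra I₁) (𝒜₂ : SolidBanachAlgebra I₂)
    (A : Tensor I₁ I₂) : ℝ :=
  max (normT1 𝒜₁ A) (normT2 𝒜₂ A)

/-- The matrix over `I₁ × I₂` through which a rank-four tensor acts on `ℓ²(I₁ × I₂)`: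
`(Ac)_{(i,k)} = Σ_{(m,n)} A_{i,k,n,m} c_{(m,n)}`. -/
def toMatrix (A : Tensor I₁ I₂) : (I₁ × I₂) → (I₁ × I₂) → ℂ :=
  fun p q => A p.1 p.2 q.2 q.1

/-- The rank-four tensor of matrix entries of an operator `T` on `ℓ²(I₁ × I₂)`:
its `(i,k,l,j)` entry is the `((i,k),(j,l))` matrix entry of `T`. -/
noncomputable def entryTensor (T : L2 (I₁ × I₂) →L[ℂ] L2 (I₁ × I₂)) : Tensor I₁ I₂ :=
  letI : DecidableEq (I₁ × I₂) := Classical.decEq _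
  fun i k l j => (T (lp.single 2 (j, l) (1 : ℂ)) : ∀ _ : I₁ × I₂, ℂ) (i, k)

/-- A set `S` of rank-four tensors is inverse-closed if, whenever `A ∈ S` acts as a boundedly
invertible operator on `ℓ²(I₁ × I₂)`, the rank-four tensor of matrix entries of the inverse
operator also belongs to `S`. -/
def InverseClosed (S : Set (Tensor I₁ I₂)) : Prop :=
  ∀ A ∈ S, ∀ T Tinv : L2 (I₁ × I₂) →L[ℂ] L2 (I₁ × I₂),
    Represents (toMatrix A) T →
    T.comp Tinv = ContinuousLinearMap.id ℂ (L2 (I₁ × I₂)) →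
    Tinv.comp T = ContinuousLinearMap.id ℂ (L2 (I₁ × I₂)) →
    entryTensor Tinv ∈ S

/-- The doubly contracted tensor product
`(A : B)_{i,k,l,j} = Σ_{n ∈ I₂} Σ_{m ∈ I₁} A_{i,k,n,m} B_{m,n,l,j}`. -/
noncomputable def contract (A B : Tensor I₁ I₂) : Tensor I₁ I₂ :=
  fun i k l j => ∑' n : I₂, ∑' m : I₁, A i k n m * B m n l j

/-- Absolute convergence of all series defining the doubly contracted tensor product. -/
def ContractSummable (A B : Tensor I₁ I₂) : Prop :=
  ∀ (i : I₁) (k l : I₂) (j : I₁),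
    Summable (fun nm : I₂ × I₁ => ‖A i k nm.1 nm.2 * B nm.2 nm.1 l j‖)

/-- The adjoint tensor `(A*)_{i,k,l,j} = conj (A_{j,l,k,i})`. -/
def adjT (A : Tensor I₁ I₂) : Tensor I₁ I₂ := fun i k l j => conj (A j l k i)



/-- A subset `I ⊂ ℝ^d` is relatively separated if the number of its points in any cube
`x + [0,1]^d` is uniformly bounded. -/
def RelSeparated {d : ℕ} (I : Set (EuclideanSpace ℝ (Fin d))) : Prop :=
  ∃ N : ℕ, ∀ x : EuclideanSpace ℝ (Fin d),
    (I ∩ {y | ∀ t : Fin d, y t ∈ Set.Icc (x t) (x t + 1)}).Finite ∧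
    (I ∩ {y | ∀ t : Fin d, y t ∈ Set.Icc (x t) (x t + 1)}).ncard ≤ N

/-- The Jaffard algebra `𝒥_s(I)`: matrices with `sup_{i,j} |A_{i,j}| (1+|i-j|)^s < ∞`. -/
def JaffardSet {d : ℕ} (I : Set (EuclideanSpace ℝ (Fin d))) (s : ℝ) :
    Set (↥I → ↥I → ℂ) :=
  {A | ∃ C : ℝ, ∀ i j : ↥I,
    ‖A i j‖ * (1 + ‖(i : EuclideanSpace ℝ (Fin d)) - (j : EuclideanSpace ℝ (Fin d))‖) ^ s ≤ C}

/-- The weighted Schur algebra `𝒮¹_δ(I)`: matrices whose weighted row and column sums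
are uniformly bounded. -/
def SchurSet {d : ℕ} (I : Set (EuclideanSpace ℝ (Fin d))) (δ : ℝ) :
    Set (↥I → ↥I → ℂ) :=
  {A | (∀ i : ↥I, Summable fun j : ↥I =>
          ‖A i j‖ * (1 + ‖(i : EuclideanSpace ℝ (Fin d)) - (j : EuclideanSpace ℝ (Fin d))‖) ^ δ) ∧
       (∀ j : ↥I, Summable fun i : ↥I =>
          ‖A i j‖ * (1 + ‖(i : EuclideanSpace ℝ (Fin d)) - (j : EuclideanSpace ℝ (Fin d))‖) ^ δ) ∧
       ∃ C : ℝ,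
        (∀ i : ↥I, (∑' j : ↥I,
          ‖A i j‖ * (1 + ‖(i : EuclideanSpace ℝ (Fin d)) - (j : EuclideanSpace ℝ (Fin d))‖) ^ δ) ≤ C) ∧
        (∀ j : ↥I, (∑' i : ↥I,
          ‖A i j‖ * (1 + ‖(i : EuclideanSpace ℝ (Fin d)) - (j : EuclideanSpace ℝ (Fin d))‖) ^ δ) ≤ C)}

/-- `ν : ℤ^d → [1,∞)` is an admissible weight: bounded below by `1`, sub-multiplicative,
symmetric, and satisfying the GRS condition. -/
def AdmissibleWeight {d : ℕ} (ν : (Fin d → ℤ) → ℝ) : Prop :=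
  (∀ x, 1 ≤ ν x) ∧
  (∀ x y, ν (x + y) ≤ ν x * ν y) ∧
  (∀ x, ν (-x) = ν x) ∧
  (∀ z : Fin d → ℤ, Filter.Tendsto (fun n : ℕ => (ν (n • z)) ^ ((n : ℝ)⁻¹))
    Filter.atTop (nhds 1))

/-- The Sjöstrand algebra `𝒞_ν` over `ℤ^d`:
matrices with `Σ_i sup_j |A_{j,j-i}| ν(i) < ∞`. -/
def SjostrandSet {d : ℕ} (ν : (Fin d → ℤ) → ℝ) :
    Set ((Fin d → ℤ) → (Fin d → ℤ) → ℂ) :=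
  {A | (∀ i : Fin d → ℤ, BddAbove (Set.range fun j : Fin d → ℤ => ‖A j (j - i)‖)) ∧
       Summable fun i : Fin d → ℤ => (⨆ j : Fin d → ℤ, ‖A j (j - i)‖) * ν i}


open scoped ENNReal NNReal

/-- A nonnegative sequence with at most geometric growth and a quasi-quadratic doubling bound
relative to a decaying geometric sequence is summable. -/
lemma summable_of_doubling_bound {a : ℕ → ℝ} {r ε L : ℝ} {d : ℕ} (ha : ∀ n, 0 ≤ a n)
    (hr0 : 0 < r) (hr1 : r < 1) (hε : 0 < ε) (hL : 0 ≤ L)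
    (hstep : ∀ n, a (n + 1) ≤ L * (a n + r ^ n))
    (hdouble : ∀ n, ∀ R : ℝ, 1 ≤ R →
      a (2 * n) ≤ L * a n * (R ^ d * r ^ n + R ^ (-ε) * a n)) :
    Summable a := by
  obtain ⟨t, ht1, htr⟩ : ∃ t : ℝ, 1 < t ∧ t ^ d * r < 1 := by
    have hc : Filter.Tendsto (fun t : ℝ => t ^ d * r) (nhdsWithin 1 (Set.Ioi 1)) (nhds r) := by
      have : Continuous fun t : ℝ => t ^ d * r := by fun_prop
      simpa using (this.tendsto 1).mono_left nhdsWithin_le_nhds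
    obtain ⟨t, h1, h2⟩ := ((hc.eventually_lt_const hr1).and self_mem_nhdsWithin).exists
    exact ⟨t, h2, h1⟩
  have ht0 : 0 < t := by linarith
  set q := max (t ^ d * r) (t ^ (-ε)) with hq
  have hq1 : q < 1 := max_lt htr (Real.rpow_lt_one_of_one_lt_of_neg ht1 (by linarith))
  have hq0 : 0 < q := lt_max_of_lt_right (Real.rpow_pos_of_pos ht0 _)
  set η := Real.sqrt q
  have hη2 : η ^ 2 = q := Real.sq_sqrt hq0.le
  have hη0 : 0 < η := Real.sqrt_pos.2 hq0
  have hη1 : η < 1 := by nlinarith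
  have hrη : r ≤ η := by
    have h1 : r ≤ t ^ d * r := le_mul_of_one_le_left hr0.le (one_le_pow₀ ht1.le)
    have h2 : t ^ d * r ≤ q := le_max_left _ _
    nlinarith
  have improve : ∀ σ : ℝ, 1 ≤ σ → (∃ M, 0 ≤ M ∧ ∀ n, a n ≤ M * σ ^ n) →
      ∃ M, 0 ≤ M ∧ ∀ n, a n ≤ M * (η * σ) ^ n := by
    rintro σ hσ ⟨M, hM, h⟩
    have hσ0 : 0 < σ := by linarith
    have even : ∀ n, a (2 * n) ≤ L * M * (1 + M) * (η * σ) ^ (2 * n) := by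
      intro n
      have h1 := hdouble n (t ^ n) (one_le_pow₀ ht1.le)
      have e1 : (t ^ n) ^ d * r ^ n ≤ q ^ n * σ ^ n := by
        rw [← pow_mul, mul_comm n d, pow_mul, ← mul_pow]
        calc (t ^ d * r) ^ n ≤ q ^ n := pow_le_pow_left₀ (by positivity) (le_max_left _ _) n
          _ ≤ q ^ n * σ ^ n := le_mul_of_one_le_right (by positivity) (one_le_pow₀ hσ)
      have e2 : (t ^ n) ^ (-ε) * a n ≤ q ^ n * (M * σ ^ n) := by
        have : (t ^ n) ^ (-ε) = (t ^ (-ε)) ^ n := by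
          rw [← Real.rpow_natCast, ← Real.rpow_mul ht0.le, ← Real.rpow_natCast,
            ← Real.rpow_mul ht0.le, mul_comm]
        rw [this]
        exact mul_le_mul (pow_le_pow_left₀ (by positivity) (le_max_right _ _) n) (h n) (ha n)
          (by positivity)
      calc a (2 * n) ≤ L * a n * ((t ^ n) ^ d * r ^ n + (t ^ n) ^ (-ε) * a n) := h1
        _ ≤ L * (M * σ ^ n) * (q ^ n * σ ^ n + q ^ n * (M * σ ^ n)) := by
          have := ha n
          have := h n
          gcongr
        _ = L * M * (1 + M) * (η * σ) ^ (2 * n) := by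
          rw [pow_mul (η * σ) 2 n, mul_pow η σ 2, hη2, mul_pow, ← pow_mul, mul_comm 2 n, pow_mul]
          ring
    set M' := L * M * (1 + M)
    have hM'0 : 0 ≤ M' := by positivity
    have hrσ : r ≤ η * σ := hrη.trans (le_mul_of_one_le_right hη0.le hσ)
    refine ⟨M' + L * (M' + 1) / (η * σ), by positivity, fun n => ?_⟩
    rcases Nat.even_or_odd' n with ⟨k, rfl | rfl⟩
    · refine (even k).trans ?_
      gcongr
      exact le_add_of_nonneg_right (by positivity)
    · calc a (2 * k + 1) ≤ L * (a (2 * k) + r ^ (2 * k)) := hstep _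
        _ ≤ L * (M' * (η * σ) ^ (2 * k) + (η * σ) ^ (2 * k)) := by
          gcongr
          exact even k
        _ = L * (M' + 1) / (η * σ) * (η * σ) ^ (2 * k + 1) := by
          field_simp
          ring
        _ ≤ _ := by
          gcongr
          exact le_add_of_nonneg_left hM'0
  by_cases hex : ∃ σ : ℝ, 0 ≤ σ ∧ σ < 1 ∧ ∃ M, 0 ≤ M ∧ ∀ n, a n ≤ M * σ ^ n
  · obtain ⟨σ, h0, h1, M, -, h⟩ := hex
    exact Summable.of_nonneg_of_le ha h ((summable_geometric_of_lt_one h0 h1).mul_left M)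
  exfalso
  have crude : ∃ M, 0 ≤ M ∧ ∀ n, a n ≤ M * (L + 1 + L) ^ n := by
    refine ⟨a 0 + 1, by linarith [ha 0], fun n => ?_⟩
    suffices a n + 1 ≤ (a 0 + 1) * (L + 1 + L) ^ n by linarith
    induction n with
    | zero => simp
    | succ n ih =>
      have h1 := hstep n
      have h2 : r ^ n ≤ 1 := pow_le_one₀ hr0.le hr1.le
      have h3 : L * (a n + r ^ n) ≤ L * (a n + 1) := by gcongr
      rw [pow_succ, ← mul_assoc]
      calc a (n + 1) + 1 ≤ (a n + 1) * (L + 1 + L) := by nlinarith [ha n]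
        _ ≤ _ := by gcongr
  have all : ∀ k : ℕ, ∃ M, 0 ≤ M ∧ ∀ n, a n ≤ M * (η ^ k * (L + 1 + L)) ^ n := by
    intro k
    induction k with
    | zero => simpa using crude
    | succ k ih =>
      have : 1 ≤ η ^ k * (L + 1 + L) := by
        by_contra! hlt
        exact hex ⟨_, by positivity, hlt, ih⟩
      rw [pow_succ', mul_assoc]
      exact improve _ this ih
  obtain ⟨k, hk⟩ := exists_pow_lt_of_lt_one (show (0 : ℝ) < 1 / (L + 1 + L) by positivity) hη1
  exact hex ⟨_, by positivity, (lt_div_iff₀ (by positivity)).1 hk, all k⟩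

section NonnegativeMatrices

variable {ι : Type*}

/-- The product of two matrices with entries in `[0, ∞]`. -/
def emul (a b : ι → ι → ℝ≥0∞) : ι → ι → ℝ≥0∞ := fun i j => ∑' k, a i k * b k j

/-- The Schur norm with weight `w` of a matrix with entries in `[0, ∞]`. -/
def schurNorm (w a : ι → ι → ℝ≥0∞) : ℝ≥0∞ :=
  (⨆ i, ∑' j, a i j * w i j) ⊔ (⨆ j, ∑' i, a i j * w i j)

/-- The Jaffard norm with weight `w` of a matrix with entries in `[0, ∞]`. -/
def jaffardNorm (w a : ι → ι → ℝ≥0∞) : ℝ≥0∞ := ⨆ i, ⨆ j, a i j * w i j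

/-- A solid norm on matrices with entries in `[0, ∞]` which dominates the unweighted Schur norm
in the interpolating sense that yields norm-controlled powers. -/
structure IsDifferentialNorm (d : ℕ) (N : (ι → ι → ℝ≥0∞) → ℝ≥0∞) : Prop where
  mono : ∀ a b, (∀ i j, a i j ≤ b i j) → N a ≤ N b
  add_le : ∀ a b, N (fun i j => a i j + b i j) ≤ N a + N b
  smul_le : ∀ (c : ℝ≥0∞) a, N (fun i j => c * a i j) ≤ c * N a
  tsum_le : ∀ f : ℕ → ι → ι → ℝ≥0∞, N (fun i j => ∑' n, f n i j) ≤ ∑' n, N (f n)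
  transpose_le : ∀ a, N (fun i j => a j i) ≤ N a
  diagonal_ne_top : ∀ a, (∀ i j, i ≠ j → a i j = 0) → (∀ i j, a i j ≤ 1) → N a ≠ ∞
  mul_le : ∃ K : ℝ≥0, ∀ a b,
    N (emul a b) ≤ K * (N a * schurNorm 1 b + schurNorm 1 a * N b)
  schur_le : ∃ C : ℝ≥0, ∃ ε : ℝ, 0 < ε ∧ ∀ R : ℝ, 1 ≤ R → ∀ (a : ι → ι → ℝ≥0∞) (B : ℝ≥0∞),
    (∀ i j, a i j ≤ B) →
      schurNorm 1 a ≤ C * (ENNReal.ofReal (R ^ d) * B + ENNReal.ofReal (R ^ (-ε)) * N a)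

lemma schurNorm_transpose (w a : ι → ι → ℝ≥0∞) (hw : ∀ i j, w i j = w j i) :
    schurNorm w (fun i j => a j i) = schurNorm w a := by
  unfold schurNorm
  rw [sup_comm]
  simp_rw [hw]

lemma row_le_schurNorm (w a : ι → ι → ℝ≥0∞) (i : ι) : ∑' j, a i j * w i j ≤ schurNorm w a :=
  (le_iSup (fun i => ∑' j, a i j * w i j) i).trans le_sup_left

lemma col_le_schurNorm (w a : ι → ι → ℝ≥0∞) (j : ι) : ∑' i, a i j * w i j ≤ schurNorm w a :=
  (le_iSup (fun j => ∑' i, a i j * w i j) j).trans le_sup_right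

lemma schurNorm_le {w a : ι → ι → ℝ≥0∞} {M : ℝ≥0∞} (h1 : ∀ i, ∑' j, a i j * w i j ≤ M)
    (h2 : ∀ j, ∑' i, a i j * w i j ≤ M) : schurNorm w a ≤ M :=
  sup_le (iSup_le h1) (iSup_le h2)

lemma le_jaffardNorm (w a : ι → ι → ℝ≥0∞) (i j : ι) : a i j * w i j ≤ jaffardNorm w a :=
  le_iSup₂ (f := fun i j => a i j * w i j) i j

variable {w : ι → ι → ℝ≥0∞} {K : ℝ≥0}

lemma row_emul_le (hw : ∀ i j k, w i j ≤ K * (w i k + w k j)) (a b : ι → ι → ℝ≥0∞) (i : ι) :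
    ∑' j, emul a b i j * w i j
      ≤ K * (schurNorm w a * schurNorm 1 b + schurNorm 1 a * schurNorm w b) := by
  have hpt : ∀ j k, a i k * b k j * w i j
      ≤ K * (a i k * w i k * b k j + a i k * (b k j * w k j)) := fun j k =>
    calc a i k * b k j * w i j ≤ a i k * b k j * (K * (w i k + w k j)) := by gcongr; exact hw i j k
      _ = _ := by ring
  calc ∑' j, emul a b i j * w i j = ∑' k, ∑' j, a i k * b k j * w i j := by
        rw [ENNReal.tsum_comm]
        simp_rw [emul, ENNReal.tsum_mul_right]
    _ ≤ ∑' k, ∑' j, K * (a i k * w i k * b k j + a i k * (b k j * w k j)) :=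
        ENNReal.tsum_le_tsum fun k => ENNReal.tsum_le_tsum fun j => hpt j k
    _ = K * (∑' k, (a i k * w i k * ∑' j, b k j + a i k * ∑' j, b k j * w k j)) := by
        simp_rw [ENNReal.tsum_mul_left, ENNReal.tsum_add, ENNReal.tsum_mul_left]
    _ ≤ K * (∑' k, (a i k * w i k * schurNorm 1 b + a i k * schurNorm w b)) := by
        gcongr with k k
        · simpa using row_le_schurNorm 1 b k
        · exact row_le_schurNorm w b k
    _ = K * ((∑' k, a i k * w i k) * schurNorm 1 b + (∑' k, a i k) * schurNorm w b) := by
        rw [ENNReal.tsum_add, ENNReal.tsum_mul_right, ENNReal.tsum_mul_right]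
    _ ≤ _ := by
        gcongr
        · exact row_le_schurNorm w a i
        · simpa using row_le_schurNorm 1 a i

lemma schurNorm_emul_le (hw : ∀ i j k, w i j ≤ K * (w i k + w k j))
    (hsymm : ∀ i j, w i j = w j i) (a b : ι → ι → ℝ≥0∞) :
    schurNorm w (emul a b)
      ≤ K * (schurNorm w a * schurNorm 1 b + schurNorm 1 a * schurNorm w b) := by
  refine schurNorm_le (row_emul_le hw a b) fun j => ?_
  have h := row_emul_le hw (fun i j => b j i) (fun i j => a j i) j
  rw [schurNorm_transpose w a hsymm, schurNorm_transpose w b hsymm,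
    schurNorm_transpose 1 a fun _ _ => rfl, schurNorm_transpose 1 b fun _ _ => rfl] at h
  calc ∑' i, emul a b i j * w i j = ∑' i, (∑' k, b k j * a i k) * w j i := by
        refine tsum_congr fun i => ?_
        rw [hsymm i j, emul]
        simp_rw [mul_comm (a i _)]
    _ ≤ _ := h
    _ = _ := by ring

lemma jaffardNorm_emul_le (hw : ∀ i j k, w i j ≤ K * (w i k + w k j)) (a b : ι → ι → ℝ≥0∞) :
    jaffardNorm w (emul a b)
      ≤ K * (jaffardNorm w a * schurNorm 1 b + schurNorm 1 a * jaffardNorm w b) := by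
  refine iSup₂_le fun i j => ?_
  calc emul a b i j * w i j = ∑' k, a i k * b k j * w i j := by
        rw [emul, ENNReal.tsum_mul_right]
    _ ≤ ∑' k, K * (a i k * w i k * b k j + a i k * (b k j * w k j)) := by
        refine ENNReal.tsum_le_tsum fun k => ?_
        calc a i k * b k j * w i j ≤ a i k * b k j * (K * (w i k + w k j)) := by
              gcongr; exact hw i j k
          _ = _ := by ring
    _ ≤ ∑' k, K * (jaffardNorm w a * b k j + a i k * jaffardNorm w b) := by
        gcongr with k
        · exact le_jaffardNorm w a i k
        · exact le_jaffardNorm w b k j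
    _ = K * (jaffardNorm w a * ∑' k, b k j + (∑' k, a i k) * jaffardNorm w b) := by
        rw [ENNReal.tsum_mul_left, ENNReal.tsum_add, ENNReal.tsum_mul_left, ENNReal.tsum_mul_right]
    _ ≤ _ := by
        gcongr
        · simpa using col_le_schurNorm 1 b j
        · simpa using row_le_schurNorm 1 a i

lemma isDifferentialNorm_schurNorm {d : ℕ} (hw : ∀ i j k, w i j ≤ K * (w i k + w k j))
    (hsymm : ∀ i j, w i j = w j i) (hdiag : ∀ i, w i i ≤ 1)
    (hint : ∃ C : ℝ≥0, ∃ ε : ℝ, 0 < ε ∧ ∀ R : ℝ, 1 ≤ R → ∀ (a : ι → ι → ℝ≥0∞) (B : ℝ≥0∞),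
      (∀ i j, a i j ≤ B) → schurNorm 1 a
        ≤ C * (ENNReal.ofReal (R ^ d) * B + ENNReal.ofReal (R ^ (-ε)) * schurNorm w a)) :
    IsDifferentialNorm d (schurNorm w) where
  mono a b h := schurNorm_le
    (fun i => (ENNReal.tsum_le_tsum fun j => by gcongr; exact h i j).trans
      (row_le_schurNorm w b i))
    (fun j => (ENNReal.tsum_le_tsum fun i => by gcongr; exact h i j).trans
      (col_le_schurNorm w b j))
  add_le a b := by
    refine schurNorm_le (fun i => ?_) (fun j => ?_) <;> simp_rw [add_mul, ENNReal.tsum_add]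
    · exact add_le_add (row_le_schurNorm w a i) (row_le_schurNorm w b i)
    · exact add_le_add (col_le_schurNorm w a j) (col_le_schurNorm w b j)
  smul_le c a := by
    refine schurNorm_le (fun i => ?_) (fun j => ?_) <;>
      simp_rw [mul_assoc, ENNReal.tsum_mul_left] <;> gcongr
    · exact row_le_schurNorm w a i
    · exact col_le_schurNorm w a j
  tsum_le f := by
    refine schurNorm_le (fun i => ?_) (fun j => ?_) <;>
      simp_rw [← ENNReal.tsum_mul_right] <;> rw [ENNReal.tsum_comm] <;> gcongr with n
    · exact row_le_schurNorm w (f n) i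
    · exact col_le_schurNorm w (f n) j
  transpose_le a := (schurNorm_transpose w a hsymm).le
  diagonal_ne_top a h0 h1 := by
    refine ne_top_of_le_ne_top ENNReal.one_ne_top (schurNorm_le (fun i => ?_) (fun i => ?_))
    · rw [tsum_eq_single i (fun j hj => by rw [h0 i j hj.symm, zero_mul])]
      exact mul_le_one' (h1 i i) (hdiag i)
    · rw [tsum_eq_single i (fun j hj => by rw [h0 j i hj, zero_mul])]
      exact mul_le_one' (h1 i i) (hdiag i)
  mul_le := ⟨K, schurNorm_emul_le hw hsymm⟩
  schur_le := hint

lemma isDifferentialNorm_jaffardNorm {d : ℕ} (hw : ∀ i j k, w i j ≤ K * (w i k + w k j))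
    (hsymm : ∀ i j, w i j = w j i) (hdiag : ∀ i, w i i ≤ 1)
    (hint : ∃ C : ℝ≥0, ∃ ε : ℝ, 0 < ε ∧ ∀ R : ℝ, 1 ≤ R → ∀ (a : ι → ι → ℝ≥0∞) (B : ℝ≥0∞),
      (∀ i j, a i j ≤ B) → schurNorm 1 a
        ≤ C * (ENNReal.ofReal (R ^ d) * B + ENNReal.ofReal (R ^ (-ε)) * jaffardNorm w a)) :
    IsDifferentialNorm d (jaffardNorm w) where
  mono a b h := iSup₂_mono fun i j => by gcongr; exact h i j
  add_le a b := iSup₂_le fun i j => by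
    rw [add_mul]
    exact add_le_add (le_jaffardNorm w a i j) (le_jaffardNorm w b i j)
  smul_le c a := iSup₂_le fun i j => by
    rw [mul_assoc]
    gcongr
    exact le_jaffardNorm w a i j
  tsum_le f := iSup₂_le fun i j => by
    rw [← ENNReal.tsum_mul_right]
    exact ENNReal.tsum_le_tsum fun n => le_jaffardNorm w (f n) i j
  transpose_le a := iSup₂_le fun i j => by
    rw [hsymm]
    exact le_jaffardNorm w a j i
  diagonal_ne_top a h0 h1 := by
    refine ne_top_of_le_ne_top ENNReal.one_ne_top (iSup₂_le fun i j => ?_)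
    rcases eq_or_ne i j with rfl | hij
    · exact mul_le_one' (h1 i i) (hdiag i)
    · simp [h0 i j hij]
  mul_le := ⟨K, jaffardNorm_emul_le hw⟩
  schur_le := hint

end NonnegativeMatrices

section Weights

variable {d : ℕ} {I : Set (EuclideanSpace ℝ (Fin d))}

/-- The polynomial weight `(1 + |i - j|) ^ s`, with values in `[0, ∞]`. -/
def polyWeight (I : Set (EuclideanSpace ℝ (Fin d))) (s : ℝ) (i j : I) : ℝ≥0∞ :=
  ENNReal.ofReal ((1 + ‖(i : EuclideanSpace ℝ (Fin d)) - j‖) ^ s)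

lemma polyWeight_symm (s : ℝ) (i j : I) : polyWeight I s i j = polyWeight I s j i := by
  rw [polyWeight, polyWeight, norm_sub_rev]

lemma polyWeight_self_le (s : ℝ) (i : I) : polyWeight I s i i ≤ 1 := by
  simp [polyWeight]

lemma polyWeight_le_mul_add {s : ℝ} (hs : 0 ≤ s) (i j k : I) :
    polyWeight I s i j
      ≤ (((2 : ℝ) ^ s).toNNReal : ℝ≥0) * (polyWeight I s i k + polyWeight I s k j) := by
  have h : ∀ {x y z : ℝ}, 0 ≤ x → 0 ≤ y → 0 ≤ z → z ≤ x + y →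
      (1 + z) ^ s ≤ 2 ^ s * ((1 + x) ^ s + (1 + y) ^ s) := by
    intro x y z hx hy hz hxy
    rcases le_total x y with hle | hle
    · calc (1 + z) ^ s ≤ (2 * (1 + y)) ^ s := by gcongr; linarith
        _ = 2 ^ s * (1 + y) ^ s := Real.mul_rpow (by norm_num) (by positivity)
        _ ≤ _ := by gcongr; exact le_add_of_nonneg_left (by positivity)
    · calc (1 + z) ^ s ≤ (2 * (1 + x)) ^ s := by gcongr; linarith
        _ = 2 ^ s * (1 + x) ^ s := Real.mul_rpow (by norm_num) (by positivity)
        _ ≤ _ := by gcongr; exact le_add_of_nonneg_right (by positivity)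
  simp only [polyWeight]
  rw [← ENNReal.ofReal_add (by positivity) (by positivity), ← ENNReal.ofReal,
    ← ENNReal.ofReal_mul (by positivity)]
  exact ENNReal.ofReal_le_ofReal (h (norm_nonneg _) (norm_nonneg _) (norm_nonneg _)
    (norm_sub_le_norm_sub_add_norm_sub _ _ _))

open Classical in
/-- The number of points of a relatively separated set in a ball of radius `R ≥ 1` is
`O(R ^ d)`, uniformly in the center. -/
lemma RelSeparated.tsum_indicator_le (hI : RelSeparated I) :
    ∃ C : ℝ≥0, ∀ (x : EuclideanSpace ℝ (Fin d)) (R : ℝ), 1 ≤ R →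
      ∑' j : I, (if ‖x - j‖ ≤ R then 1 else 0 : ℝ≥0∞) ≤ C * ENNReal.ofReal (R ^ d) := by
  obtain ⟨N, hN⟩ := hI
  refine ⟨N * 5 ^ d, fun x R hR => ?_⟩
  set M : ℤ := ⌈R⌉ with hM
  have hMR : (M : ℝ) < R + 1 := Int.ceil_lt_add_one R
  have hRM : R ≤ M := Int.le_ceil R
  have hM0 : 0 ≤ M := by
    have : (0 : ℝ) ≤ M := by linarith
    exact_mod_cast this
  set box : Finset (Fin d → ℤ) := Fintype.piFinset fun _ => Finset.Icc (-M) M with hbox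
  let corner : (Fin d → ℤ) → EuclideanSpace ℝ (Fin d) := fun n => x + WithLp.toLp 2 fun t => (n t : ℝ)
  let cube : (Fin d → ℤ) → Set (EuclideanSpace ℝ (Fin d)) := fun n =>
    {y | ∀ t : Fin d, y t ∈ Set.Icc (corner n t) (corner n t + 1)}
  have hcube : ∀ n, ∑' j : I, (if (j : EuclideanSpace ℝ (Fin d)) ∈ cube n then 1 else 0 : ℝ≥0∞)
      ≤ N := by
    intro n
    obtain ⟨hf, hc⟩ := hN (corner n)
    have h1 : ∑' j : I, (if (j : EuclideanSpace ℝ (Fin d)) ∈ cube n then 1 else 0 : ℝ≥0∞)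
        = ∑' j : (I ∩ cube n : Set _), (1 : ℝ≥0∞) := by
      rw [tsum_subtype I (fun j => if j ∈ cube n then (1 : ℝ≥0∞) else 0),
        tsum_subtype (I ∩ cube n) (fun _ => (1 : ℝ≥0∞))]
      refine tsum_congr fun j => ?_
      by_cases h1 : j ∈ I <;> by_cases h2 : j ∈ cube n <;> simp [h1, h2]
    rw [h1, ENNReal.tsum_set_one, ← hf.cast_ncard_eq]
    exact_mod_cast hc
  have hcover : ∀ j : I, (if ‖x - j‖ ≤ R then 1 else 0 : ℝ≥0∞)
      ≤ ∑ n ∈ box, (if (j : EuclideanSpace ℝ (Fin d)) ∈ cube n then 1 else 0 : ℝ≥0∞) := by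
    intro j
    split_ifs with hj
    swap
    · exact zero_le
    set n : Fin d → ℤ := fun t => ⌊(j : EuclideanSpace ℝ (Fin d)) t - x t⌋ with hn
    have hmem : n ∈ box := by
      rw [hbox, Fintype.mem_piFinset]
      intro t
      have h1 : |(j : EuclideanSpace ℝ (Fin d)) t - x t| ≤ R := by
        have := (PiLp.norm_apply_le (x - (j : EuclideanSpace ℝ (Fin d))) t).trans hj
        rwa [PiLp.sub_apply, Real.norm_eq_abs, abs_sub_comm] at this
      rw [abs_le] at h1
      rw [Finset.mem_Icc, hn, Int.le_floor]
      refine ⟨by push_cast; linarith, ?_⟩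
      have : ((⌊(j : EuclideanSpace ℝ (Fin d)) t - x t⌋ : ℤ) : ℝ) ≤ M :=
        (Int.floor_le _).trans (h1.2.trans hRM)
      exact_mod_cast this
    refine le_trans (le_of_eq ?_)
      (Finset.single_le_sum (f := fun n => (if (j : EuclideanSpace ℝ (Fin d)) ∈ cube n
        then 1 else 0 : ℝ≥0∞)) (fun _ _ => zero_le) hmem)
    rw [if_pos]
    intro t
    have h1 := Int.floor_le ((j : EuclideanSpace ℝ (Fin d)) t - x t)
    have h2 := Int.lt_floor_add_one ((j : EuclideanSpace ℝ (Fin d)) t - x t)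
    simp only [corner, PiLp.add_apply, hn, Set.mem_Icc]
    constructor <;> linarith
  have hcard : (box.card : ℝ) ≤ 5 ^ d * R ^ d := by
    rw [hbox, Fintype.card_piFinset_const, Int.card_Icc, ← mul_pow]
    push_cast
    have : (((M + 1 - -M).toNat : ℕ) : ℝ) = 2 * M + 1 := by
      have h : (((M + 1 - -M).toNat : ℕ) : ℤ) = 2 * M + 1 := by
        rw [Int.toNat_of_nonneg (by omega)]; ring
      exact_mod_cast h
    rw [this]
    gcongr
    linarith
  calc ∑' j : I, (if ‖x - j‖ ≤ R then 1 else 0 : ℝ≥0∞)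
      ≤ ∑' j : I, ∑ n ∈ box, (if (j : EuclideanSpace ℝ (Fin d)) ∈ cube n then 1 else 0 : ℝ≥0∞) :=
        ENNReal.tsum_le_tsum hcover
    _ = ∑ n ∈ box, ∑' j : I, (if (j : EuclideanSpace ℝ (Fin d)) ∈ cube n then 1 else 0 : ℝ≥0∞) :=
        Summable.tsum_finsetSum fun _ _ => ENNReal.summable
    _ ≤ ∑ n ∈ box, (N : ℝ≥0∞) := Finset.sum_le_sum fun n _ => hcube n
    _ = N * ENNReal.ofReal box.card := by
        rw [Finset.sum_const, nsmul_eq_mul, mul_comm, ENNReal.ofReal_natCast]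
    _ ≤ N * ENNReal.ofReal (5 ^ d * R ^ d) := by gcongr
    _ = _ := by
        rw [ENNReal.ofReal_mul (by positivity), ENNReal.ofReal_pow (by norm_num)]
        push_cast
        rw [mul_assoc]
        norm_num

open Classical in
lemma RelSeparated.tsum_rpow_le (hI : RelSeparated I) {t : ℝ} (ht : (d : ℝ) < t) :
    ∃ C : ℝ≥0, ∀ x : EuclideanSpace ℝ (Fin d),
      ∑' j : I, ENNReal.ofReal ((1 + ‖x - j‖) ^ (-t)) ≤ C := by
  obtain ⟨C, hC⟩ := hI.tsum_indicator_le
  have ht0 : 0 < t := (Nat.cast_nonneg d).trans_lt ht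
  set q : ℝ := 2 ^ ((d : ℝ) - t) with hq
  have hq0 : 0 < q := by positivity
  have hq1 : q < 1 := Real.rpow_lt_one_of_one_lt_of_neg (by norm_num) (by linarith)
  have hgeom : ∑' m : ℕ, ENNReal.ofReal (q ^ m) ≠ ∞ :=
    (summable_geometric_of_lt_one hq0.le hq1).tsum_ofReal_ne_top
  have hpt : ∀ (x : EuclideanSpace ℝ (Fin d)) (j : I), ENNReal.ofReal ((1 + ‖x - j‖) ^ (-t))
      ≤ ∑' m : ℕ, ENNReal.ofReal (2 ^ t * ((2 : ℝ) ^ m) ^ (-t)) *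
        (if ‖x - j‖ ≤ (2 : ℝ) ^ m then 1 else 0) := by
    intro x j
    have hex : ∃ m : ℕ, ‖x - j‖ ≤ (2 : ℝ) ^ m :=
      (pow_unbounded_of_one_lt ‖x - j‖ one_lt_two).imp fun _ h => h.le
    refine le_trans ?_ (ENNReal.le_tsum (Nat.find hex))
    rw [if_pos (Nat.find_spec hex), mul_one]
    refine ENNReal.ofReal_le_ofReal ?_
    rw [Real.rpow_neg (by positivity), Real.rpow_neg (by positivity), ← div_eq_mul_inv,
      inv_eq_one_div, ← Real.div_rpow (by norm_num) (by positivity), ← Real.one_rpow t,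
      ← Real.div_rpow (by norm_num) (by positivity), Real.one_rpow]
    refine Real.rpow_le_rpow (by positivity) ?_ ht0.le
    rw [div_le_div_iff₀ (by positivity) (by positivity)]
    rcases hm : Nat.find hex with _ | m
    · have := norm_nonneg (x - (j : EuclideanSpace ℝ (Fin d)))
      rw [pow_zero]; linarith
    · have := Nat.find_min hex (m := m) (by omega)
      rw [pow_succ]; linarith
  refine ⟨(ENNReal.ofReal (2 ^ t) * C * ∑' m : ℕ, ENNReal.ofReal (q ^ m)).toNNReal, fun x => ?_⟩
  rw [ENNReal.coe_toNNReal (ENNReal.mul_ne_top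
    (ENNReal.mul_ne_top ENNReal.ofReal_ne_top ENNReal.coe_ne_top) hgeom)]
  calc ∑' j : I, ENNReal.ofReal ((1 + ‖x - j‖) ^ (-t))
      ≤ ∑' j : I, ∑' m : ℕ, ENNReal.ofReal (2 ^ t * ((2 : ℝ) ^ m) ^ (-t)) *
        (if ‖x - j‖ ≤ (2 : ℝ) ^ m then 1 else 0) := ENNReal.tsum_le_tsum (hpt x)
    _ = ∑' m : ℕ, ENNReal.ofReal (2 ^ t * ((2 : ℝ) ^ m) ^ (-t)) *
        ∑' j : I, (if ‖x - j‖ ≤ (2 : ℝ) ^ m then 1 else 0) := by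
        rw [ENNReal.tsum_comm]
        simp_rw [ENNReal.tsum_mul_left]
    _ ≤ ∑' m : ℕ, ENNReal.ofReal (2 ^ t * ((2 : ℝ) ^ m) ^ (-t)) *
        (C * ENNReal.ofReal (((2 : ℝ) ^ m) ^ d)) := by
        gcongr with m
        exact hC x _ (one_le_pow₀ one_le_two)
    _ = ∑' m : ℕ, ENNReal.ofReal (2 ^ t) * C * ENNReal.ofReal (q ^ m) := by
        refine tsum_congr fun m => ?_
        have : q ^ m = ((2 : ℝ) ^ m) ^ (-t) * ((2 : ℝ) ^ m) ^ d := by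
          rw [hq, ← Real.rpow_natCast _ d, ← Real.rpow_add (by positivity),
            ← Real.rpow_natCast _ m, ← Real.rpow_natCast _ m, ← Real.rpow_mul (by norm_num),
            ← Real.rpow_mul (by norm_num)]
          ring_nf
        rw [this, ENNReal.ofReal_mul (by positivity), ENNReal.ofReal_mul (by positivity)]
        ring
    _ = _ := ENNReal.tsum_mul_left

lemma RelSeparated.schurNorm_one_le (hI : RelSeparated I) :
    ∃ C : ℝ≥0, ∀ ε : ℝ, 0 < ε → ∀ R : ℝ, 1 ≤ R → ∀ (a : I → I → ℝ≥0∞) (B : ℝ≥0∞),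
      (∀ i j, a i j ≤ B) → schurNorm 1 a ≤ C * (ENNReal.ofReal (R ^ d) * B)
        + ENNReal.ofReal (R ^ (-ε)) * schurNorm (polyWeight I ε) a := by
  classical
  obtain ⟨C, hC⟩ := hI.tsum_indicator_le
  refine ⟨C, fun ε hε R hR a B haB => ?_⟩
  have hpt : ∀ i j : I, a i j ≤ B * (if ‖(i : EuclideanSpace ℝ (Fin d)) - j‖ ≤ R then 1 else 0)
      + ENNReal.ofReal (R ^ (-ε)) * (a i j * polyWeight I ε i j) := by
    intro i j
    split_ifs with h
    · rw [mul_one]; exact (haB i j).trans le_self_add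
    · rw [mul_zero, zero_add, mul_left_comm]
      refine le_mul_of_one_le_right' ?_
      rw [polyWeight, ← ENNReal.ofReal_mul (by positivity), ENNReal.one_le_ofReal]
      rw [Real.rpow_neg (by positivity), inv_mul_eq_div, one_le_div (by positivity)]
      exact Real.rpow_le_rpow (by positivity) (by linarith) hε.le
  refine schurNorm_le (fun i => ?_) (fun j => ?_)
  · calc ∑' j, a i j * (1 : I → I → ℝ≥0∞) i j = ∑' j, a i j := by simp
      _ ≤ _ := ENNReal.tsum_le_tsum (hpt i)
      _ = B * (∑' j : I, if ‖(i : EuclideanSpace ℝ (Fin d)) - j‖ ≤ R then 1 else 0)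
          + ENNReal.ofReal (R ^ (-ε)) * ∑' j, a i j * polyWeight I ε i j := by
        rw [ENNReal.tsum_add, ENNReal.tsum_mul_left, ENNReal.tsum_mul_left]
      _ ≤ B * (C * ENNReal.ofReal (R ^ d))
          + ENNReal.ofReal (R ^ (-ε)) * schurNorm (polyWeight I ε) a := by
        gcongr
        · exact hC i R hR
        · exact row_le_schurNorm _ a i
      _ = _ := by ring
  · calc ∑' i, a i j * (1 : I → I → ℝ≥0∞) i j = ∑' i, a i j := by simp
      _ ≤ _ := ENNReal.tsum_le_tsum fun i => hpt i j
      _ = B * (∑' i : I, if ‖(j : EuclideanSpace ℝ (Fin d)) - i‖ ≤ R then 1 else 0)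
          + ENNReal.ofReal (R ^ (-ε)) * ∑' i, a i j * polyWeight I ε i j := by
        rw [ENNReal.tsum_add, ENNReal.tsum_mul_left, ENNReal.tsum_mul_left]
        simp_rw [norm_sub_rev (j : EuclideanSpace ℝ (Fin d))]
      _ ≤ B * (C * ENNReal.ofReal (R ^ d))
          + ENNReal.ofReal (R ^ (-ε)) * schurNorm (polyWeight I ε) a := by
        gcongr
        · exact hC j R hR
        · exact col_le_schurNorm _ a j
      _ = _ := by ring

lemma RelSeparated.schurNorm_le_jaffardNorm (hI : RelSeparated I) {ε s : ℝ}
    (hs : (d : ℝ) + ε < s) : ∃ C : ℝ≥0, ∀ a : I → I → ℝ≥0∞,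
      schurNorm (polyWeight I ε) a ≤ C * jaffardNorm (polyWeight I s) a := by
  obtain ⟨C, hC⟩ := hI.tsum_rpow_le (t := s - ε) (by linarith)
  refine ⟨C, fun a => ?_⟩
  have hpt : ∀ i j : I, a i j * polyWeight I ε i j ≤ jaffardNorm (polyWeight I s) a *
      ENNReal.ofReal ((1 + ‖(i : EuclideanSpace ℝ (Fin d)) - j‖) ^ (-(s - ε))) := by
    intro i j
    refine le_trans (le_of_eq ?_) (mul_le_mul_left (le_jaffardNorm (polyWeight I s) a i j) _)
    rw [mul_assoc, polyWeight, polyWeight, ← ENNReal.ofReal_mul (by positivity),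
      ← Real.rpow_add (by positivity)]
    ring_nf
  refine schurNorm_le (fun i => ?_) (fun j => ?_)
  · refine (ENNReal.tsum_le_tsum (hpt i)).trans ?_
    rw [ENNReal.tsum_mul_left, mul_comm]
    gcongr
    exact hC i
  · refine (ENNReal.tsum_le_tsum fun i => hpt i j).trans ?_
    simp_rw [norm_sub_rev _ (j : EuclideanSpace ℝ (Fin d))]
    rw [ENNReal.tsum_mul_left, mul_comm]
    gcongr
    exact hC j

lemma RelSeparated.isDifferentialNorm_schurNorm (hI : RelSeparated I) {δ : ℝ} (hδ : 0 < δ) :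
    IsDifferentialNorm d (schurNorm (polyWeight I δ)) := by
  obtain ⟨C, hC⟩ := hI.schurNorm_one_le
  refine PaperTensor.isDifferentialNorm_schurNorm (polyWeight_le_mul_add hδ.le) (polyWeight_symm δ)
    (polyWeight_self_le δ) ⟨C + 1, δ, hδ, fun R hR a B haB => (hC δ hδ R hR a B haB).trans ?_⟩
  rw [mul_add]
  exact add_le_add (mul_le_mul_left (by simp) _) (le_mul_of_one_le_left' (by simp))

lemma RelSeparated.isDifferentialNorm_jaffardNorm (hI : RelSeparated I) {s : ℝ}
    (hs : (d : ℝ) < s) : IsDifferentialNorm d (jaffardNorm (polyWeight I s)) := by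
  have hs0 : 0 < s := (Nat.cast_nonneg d).trans_lt hs
  obtain ⟨C, hC⟩ := hI.schurNorm_one_le
  have hε : 0 < (s - d) / 2 := by linarith
  obtain ⟨C', hC'⟩ := hI.schurNorm_le_jaffardNorm (ε := (s - d) / 2) (s := s) (by linarith)
  refine PaperTensor.isDifferentialNorm_jaffardNorm (polyWeight_le_mul_add hs0.le)
    (polyWeight_symm s) (polyWeight_self_le s)
    ⟨C + C', (s - d) / 2, hε, fun R hR a B haB => (hC _ hε R hR a B haB).trans ?_⟩
  calc _ ≤ C * (ENNReal.ofReal (R ^ d) * B) + ENNReal.ofReal (R ^ (-((s - d) / 2))) *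
        (C' * jaffardNorm (polyWeight I s) a) := by gcongr; exact hC' a
    _ = C * (ENNReal.ofReal (R ^ d) * B) + C' * (ENNReal.ofReal (R ^ (-((s - d) / 2))) *
        jaffardNorm (polyWeight I s) a) := by ring
    _ ≤ _ := by
      rw [mul_add]
      exact add_le_add (mul_le_mul_left (by simp) _) (mul_le_mul_left (by simp) _)

end Weights

section Blocks

variable {ι H K : Type*} [NormedAddCommGroup H] [InnerProductSpace ℂ H] [CompleteSpace H]
  [NormedAddCommGroup K] [InnerProductSpace ℂ K] [CompleteSpace K]

open ContinuousLinearMap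

/-- The maps `J i` embed copies of `K` as mutually orthogonal subspaces which span `H`. -/
structure IsBlockDecomposition (J : ι → K →L[ℂ] H) : Prop where
  norm_le : ∀ i, ‖J i‖ ≤ 1
  orthogonal : ∀ i j, i ≠ j → adjoint (J i) ∘L J j = 0
  hasSum : ∀ x : H, HasSum (fun i => J i (adjoint (J i) x)) x

/-- The norms of the blocks of the operator `X` with respect to the embeddings `J`. -/
def blockNorm (J : ι → K →L[ℂ] H) (X : H →L[ℂ] H) : ι → ι → ℝ≥0∞ := fun i j =>
  ‖adjoint (J i) ∘L X ∘L J j‖ₑ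

variable {J : ι → K →L[ℂ] H}

lemma blockNorm_add_le (X Y : H →L[ℂ] H) (i j : ι) :
    blockNorm J (X + Y) i j ≤ blockNorm J X i j + blockNorm J Y i j := by
  simp only [blockNorm, add_comp, comp_add]
  exact enorm_add_le _ _

lemma blockNorm_smul (c : ℂ) (X : H →L[ℂ] H) (i j : ι) :
    blockNorm J (c • X) i j = ‖c‖ₑ * blockNorm J X i j := by
  simp only [blockNorm, smul_comp, comp_smul, enorm_smul]

lemma blockNorm_adjoint (X : H →L[ℂ] H) (i j : ι) :
    blockNorm J (adjoint X) i j = blockNorm J X j i := by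
  have : adjoint (J i) ∘L adjoint X ∘L J j = adjoint (adjoint (J j) ∘L X ∘L J i) := by
    simp [adjoint_comp, comp_assoc]
  simp only [blockNorm, this, ← ofReal_norm, LinearIsometryEquiv.norm_map]

lemma IsBlockDecomposition.blockNorm_le (hJ : IsBlockDecomposition J) (X : H →L[ℂ] H) (i j : ι) :
    blockNorm J X i j ≤ ‖X‖ₑ := by
  simp only [blockNorm, ← ofReal_norm]
  refine ENNReal.ofReal_le_ofReal ?_
  calc ‖adjoint (J i) ∘L X ∘L J j‖ ≤ ‖adjoint (J i)‖ * (‖X‖ * ‖J j‖) :=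
        (opNorm_comp_le _ _).trans (by gcongr; exact opNorm_comp_le _ _)
    _ ≤ 1 * (‖X‖ * 1) := by
        gcongr
        · rw [LinearIsometryEquiv.norm_map]; exact hJ.norm_le i
        · exact hJ.norm_le j
    _ = ‖X‖ := by ring

lemma IsBlockDecomposition.blockNorm_mul_le (hJ : IsBlockDecomposition J) (X Y : H →L[ℂ] H)
    (i j : ι) : blockNorm J (X * Y) i j ≤ emul (blockNorm J X) (blockNorm J Y) i j := by
  refine opENorm_le_bound _ fun v => ?_
  have hsum : HasSum (fun k => (adjoint (J i) ∘L X ∘L J k) ((adjoint (J k) ∘L Y ∘L J j) v))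
      ((adjoint (J i) ∘L (X * Y) ∘L J j) v) := by
    simpa using (hJ.hasSum (Y (J j v))).mapL (adjoint (J i) ∘L X)
  rw [← hsum.tsum_eq, emul, ← ENNReal.tsum_mul_right]
  refine enorm_tsum_le_tsum_enorm.trans (ENNReal.tsum_le_tsum fun k => ?_)
  rw [mul_assoc]
  refine (le_opENorm (adjoint (J i) ∘L X ∘L J k) _).trans ?_
  exact mul_le_mul' le_rfl (le_opENorm (adjoint (J k) ∘L Y ∘L J j) v)

lemma blockNorm_tsum_le {f : ℕ → H →L[ℂ] H} (hf : Summable f) (i j : ι) :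
    blockNorm J (∑' n, f n) i j ≤ ∑' n, blockNorm J (f n) i j := by
  refine opENorm_le_bound _ fun v => ?_
  have hsum : HasSum (fun n => (adjoint (J i) ∘L f n ∘L J j) v)
      ((adjoint (J i) ∘L (∑' n, f n) ∘L J j) v) := by
    simpa using (hf.hasSum.mapL (apply ℂ H (J j v))).mapL (adjoint (J i))
  rw [← hsum.tsum_eq, ← ENNReal.tsum_mul_right]
  exact enorm_tsum_le_tsum_enorm.trans (ENNReal.tsum_le_tsum fun n => le_opENorm _ _)

/-- A suitable multiple of `T† T` is at distance less than one from the identity if `T` is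
bounded below. -/
lemma exists_norm_one_sub_smul_adjoint_mul_lt {T S : H →L[ℂ] H} (hST : S * T = 1) :
    ∃ c : ℝ, 0 < c ∧ ‖1 - (c : ℂ) • (adjoint T * T)‖ < 1 := by
  set c : ℝ := 1 / (1 + ‖T‖ ^ 2) with hc
  have hc0 : 0 < c := by positivity
  have hcT : c * ‖T‖ ^ 2 ≤ 1 := by
    rw [hc, one_div_mul_eq_div, div_le_one (by positivity)]; linarith
  have hc1 : c ≤ 1 := by
    rw [hc, div_le_one (by positivity)]; nlinarith [norm_nonneg T]
  set m : ℝ := 1 / (1 + ‖S‖) ^ 2 with hm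
  have hm0 : 0 < m := by positivity
  have hm1 : m ≤ 1 := by
    rw [hm, div_le_one (by positivity)]; nlinarith [norm_nonneg S]
  have hcm : c * m ≤ 1 := mul_le_one₀ hc1 hm0.le hm1
  refine ⟨c, hc0, ?_⟩
  suffices ‖1 - (c : ℂ) • (adjoint T * T)‖ ≤ Real.sqrt (1 - c * m) from
    this.trans_lt (by rw [Real.sqrt_lt' one_pos]; nlinarith [mul_pos hc0 hm0])
  refine opNorm_le_bound _ (Real.sqrt_nonneg _) fun x => ?_
  rw [← sq_le_sq₀ (norm_nonneg _) (by positivity), mul_pow, Real.sq_sqrt (by linarith)]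
  have hlow : m * ‖x‖ ^ 2 ≤ ‖T x‖ ^ 2 := by
    have h1 : ‖x‖ ≤ (1 + ‖S‖) * ‖T x‖ := by
      have h2 : S (T x) = x := by simpa using DFunLike.congr_fun hST x
      calc ‖x‖ = ‖S (T x)‖ := by rw [h2]
        _ ≤ ‖S‖ * ‖T x‖ := S.le_opNorm _
        _ ≤ _ := by gcongr; linarith
    rw [hm, one_div_mul_eq_div, div_le_iff₀ (by positivity), mul_comm, ← mul_pow]
    gcongr
  have hup : ‖adjoint T (T x)‖ ^ 2 ≤ ‖T‖ ^ 2 * ‖T x‖ ^ 2 := by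
    rw [← mul_pow]
    gcongr
    simpa using (adjoint T).le_opNorm (T x)
  have hinner : RCLike.re (inner ℂ x ((c : ℂ) • adjoint T (T x))) = c * ‖T x‖ ^ 2 := by
    rw [inner_smul_right, adjoint_inner_right, inner_self_eq_norm_sq_to_K]
    norm_cast
    exact Complex.re_ofReal_mul _ _
  have hexp : (1 - (c : ℂ) • (adjoint T * T)) x = x - (c : ℂ) • adjoint T (T x) := by simp
  rw [hexp, norm_sub_sq (𝕜 := ℂ), hinner, norm_smul, Complex.norm_of_nonneg hc0.le, mul_pow]
  have h3 : c ^ 2 * ‖adjoint T (T x)‖ ^ 2 ≤ c * ‖T x‖ ^ 2 :=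
    calc c ^ 2 * ‖adjoint T (T x)‖ ^ 2 ≤ c ^ 2 * (‖T‖ ^ 2 * ‖T x‖ ^ 2) := by gcongr
      _ = (c * ‖T‖ ^ 2) * (c * ‖T x‖ ^ 2) := by ring
      _ ≤ 1 * (c * ‖T x‖ ^ 2) := by gcongr
      _ = _ := one_mul _
  have h4 := mul_le_mul_of_nonneg_left hlow hc0.le
  linarith

namespace IsDifferentialNorm

variable {d : ℕ} {N : (ι → ι → ℝ≥0∞) → ℝ≥0∞}

lemma schurNorm_ne_top (hN : IsDifferentialNorm d N) (hJ : IsBlockDecomposition J)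
    {X : H →L[ℂ] H} (hX : N (blockNorm J X) ≠ ∞) : schurNorm 1 (blockNorm J X) ≠ ∞ := by
  obtain ⟨C, ε, -, h⟩ := hN.schur_le
  refine ne_top_of_le_ne_top ?_ (h 1 le_rfl _ _ (hJ.blockNorm_le X))
  finiteness

lemma blockNorm_mul_ne_top (hN : IsDifferentialNorm d N) (hJ : IsBlockDecomposition J)
    {X Y : H →L[ℂ] H} (hX : N (blockNorm J X) ≠ ∞) (hY : N (blockNorm J Y) ≠ ∞) :
    N (blockNorm J (X * Y)) ≠ ∞ := by
  obtain ⟨C, h⟩ := hN.mul_le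
  refine ne_top_of_le_ne_top ?_ ((hN.mono _ _ (hJ.blockNorm_mul_le X Y)).trans (h _ _))
  have := hN.schurNorm_ne_top hJ hX
  have := hN.schurNorm_ne_top hJ hY
  finiteness

lemma blockNorm_adjoint_ne_top (hN : IsDifferentialNorm d N) {X : H →L[ℂ] H}
    (hX : N (blockNorm J X) ≠ ∞) : N (blockNorm J (adjoint X)) ≠ ∞ := by
  have : blockNorm J (adjoint X) = fun i j => blockNorm J X j i := by
    ext i j; exact blockNorm_adjoint X i j
  rw [this]
  exact ne_top_of_le_ne_top hX (hN.transpose_le _)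

lemma blockNorm_smul_ne_top (hN : IsDifferentialNorm d N) (c : ℂ) {X : H →L[ℂ] H}
    (hX : N (blockNorm J X) ≠ ∞) : N (blockNorm J (c • X)) ≠ ∞ := by
  refine ne_top_of_le_ne_top ?_
    ((hN.mono _ _ fun i j => (blockNorm_smul c X i j).le).trans (hN.smul_le _ _))
  finiteness

lemma blockNorm_add_ne_top (hN : IsDifferentialNorm d N) {X Y : H →L[ℂ] H}
    (hX : N (blockNorm J X) ≠ ∞) (hY : N (blockNorm J Y) ≠ ∞) :
    N (blockNorm J (X + Y)) ≠ ∞ :=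
  ne_top_of_le_ne_top (ENNReal.add_ne_top.2 ⟨hX, hY⟩)
    ((hN.mono _ _ (blockNorm_add_le X Y)).trans (hN.add_le _ _))

lemma blockNorm_one_ne_top (hN : IsDifferentialNorm d N) (hJ : IsBlockDecomposition J) :
    N (blockNorm J (1 : H →L[ℂ] H)) ≠ ∞ := by
  refine hN.diagonal_ne_top _ (fun i j hij => ?_) fun i j => ?_
  · rw [blockNorm, one_def, id_comp, hJ.orthogonal i j hij, enorm_zero]
  · refine (hJ.blockNorm_le 1 i j).trans ?_
    rw [← ofReal_norm, ENNReal.ofReal_le_one]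
    exact norm_id_le

lemma tsum_blockNorm_pow_ne_top (hN : IsDifferentialNorm d N) (hJ : IsBlockDecomposition J)
    {X : H →L[ℂ] H} (hX : N (blockNorm J X) ≠ ∞) (hX1 : ‖X‖ < 1) :
    ∑' n : ℕ, N (blockNorm J (X ^ n)) ≠ ∞ := by
  have hfin : ∀ n : ℕ, N (blockNorm J (X ^ n)) ≠ ∞ := by
    intro n
    induction n with
    | zero => simpa using hN.blockNorm_one_ne_top hJ
    | succ n ih => rw [pow_succ]; exact hN.blockNorm_mul_ne_top hJ ih hX
  obtain ⟨r, hXr, hr1⟩ := exists_between hX1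
  have hr0 : 0 < r := (norm_nonneg X).trans_lt hXr
  set a : ℕ → ℝ := fun n => (N (blockNorm J (X ^ n))).toReal with ha
  have haN : ∀ n, N (blockNorm J (X ^ n)) = ENNReal.ofReal (a n) := fun n =>
    (ENNReal.ofReal_toReal (hfin n)).symm
  have ha0 : ∀ n, 0 ≤ a n := fun n => ENNReal.toReal_nonneg
  obtain ⟨K, hK⟩ := hN.mul_le
  obtain ⟨C, ε, hε, hC⟩ := hN.schur_le
  have hmul : ∀ m n, N (blockNorm J (X ^ (m + n))) ≤ K * (N (blockNorm J (X ^ m)) *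
      schurNorm 1 (blockNorm J (X ^ n)) + schurNorm 1 (blockNorm J (X ^ m)) *
      N (blockNorm J (X ^ n))) := fun m n => by
    rw [pow_add]
    exact (hN.mono _ _ (hJ.blockNorm_mul_le _ _)).trans (hK _ _)
  have hS : ∀ n, ∀ R : ℝ, 1 ≤ R → schurNorm 1 (blockNorm J (X ^ n))
      ≤ ENNReal.ofReal (C * (R ^ d * r ^ n + R ^ (-ε) * a n)) := by
    intro n R hR
    have hR0 : 0 < R := by linarith
    have hb : ∀ i j, blockNorm J (X ^ n) i j ≤ ENNReal.ofReal (r ^ n) := fun i j => by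
      refine (hJ.blockNorm_le _ i j).trans ?_
      rw [← ofReal_norm]
      refine ENNReal.ofReal_le_ofReal ?_
      rcases n.eq_zero_or_pos with rfl | hn
      · rw [pow_zero, pow_zero]; exact norm_id_le
      · exact (norm_pow_le' X hn).trans (by gcongr)
    refine (hC R hR _ _ hb).trans (le_of_eq ?_)
    have := ha0 n
    rw [haN, ENNReal.ofReal_mul (by positivity), ENNReal.ofReal_add (by positivity)
      (by positivity), ENNReal.ofReal_mul (by positivity), ENNReal.ofReal_mul (by positivity),
      ENNReal.ofReal_coe_nnreal]
  have hmulS : ∀ m n, ∀ x y : ℝ, 0 ≤ x → 0 ≤ y →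
      schurNorm 1 (blockNorm J (X ^ m)) ≤ ENNReal.ofReal x →
      schurNorm 1 (blockNorm J (X ^ n)) ≤ ENNReal.ofReal y →
      a (m + n) ≤ K * (a m * y + x * a n) := by
    intro m n x y hx hy hmx hny
    have := ha0 m
    have := ha0 n
    rw [← ENNReal.ofReal_le_ofReal_iff (by positivity), ← haN,
      ENNReal.ofReal_mul (by positivity), ENNReal.ofReal_add (by positivity) (by positivity),
      ENNReal.ofReal_mul (by positivity), ENNReal.ofReal_mul (by positivity),
      ENNReal.ofReal_coe_nnreal, ← haN, ← haN]
    refine (hmul m n).trans ?_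
    gcongr
  set S : ℝ := C * (r + a 1)
  have hS0 : 0 ≤ S := by have := ha0 1; positivity
  have hS1 : schurNorm 1 (blockNorm J (X ^ 1)) ≤ ENNReal.ofReal S := by
    simpa only [one_pow, pow_one, Real.one_rpow, one_mul] using hS 1 1 le_rfl
  have hsum : Summable a := by
    refine summable_of_doubling_bound (r := r) (ε := ε) (d := d)
      (L := K * (S + C * a 1) + 2 * K * C) ha0 hr0 hr1 hε ?_ (fun n => ?_) (fun n R hR => ?_)
    · have := ha0 1
      positivity
    · have h1 := hS n 1 le_rfl
      simp only [one_pow, one_mul, Real.one_rpow] at h1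
      have := ha0 n
      have := ha0 1
      calc a (n + 1) ≤ K * (a n * S + C * (r ^ n + a n) * a 1) :=
            hmulS n 1 _ _ (by positivity) hS0 h1 hS1
        _ ≤ K * ((a n + r ^ n) * S + C * (r ^ n + a n) * a 1) := by
            gcongr
            exact le_add_of_nonneg_right (by positivity)
        _ = K * (S + C * a 1) * (a n + r ^ n) := by ring
        _ ≤ _ := by
            gcongr
            exact le_add_of_nonneg_right (by positivity)
    · have h1 := hS n R hR
      have hR0 : 0 < R := by linarith
      have := ha0 n
      have := ha0 1
      rw [two_mul]
      calc a (n + n) ≤ K * (a n * (C * (R ^ d * r ^ n + R ^ (-ε) * a n))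
            + C * (R ^ d * r ^ n + R ^ (-ε) * a n) * a n) :=
            hmulS n n _ _ (by positivity) (by positivity) h1 h1
        _ = 2 * K * C * a n * (R ^ d * r ^ n + R ^ (-ε) * a n) := by ring
        _ ≤ _ := by
            gcongr
            exact le_add_of_nonneg_left (by positivity)
  simp_rw [haN]
  exact hsum.tsum_ofReal_ne_top

/-- Finiteness of a differential norm of the block norms passes to inverses. -/
theorem blockNorm_inverse_ne_top (hN : IsDifferentialNorm d N) (hJ : IsBlockDecomposition J)
    {T S : H →L[ℂ] H} (hTS : T * S = 1) (hST : S * T = 1) (hT : N (blockNorm J T) ≠ ∞) :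
    N (blockNorm J S) ≠ ∞ := by
  obtain ⟨c, hc0, hc⟩ := exists_norm_one_sub_smul_adjoint_mul_lt hST
  set X : H →L[ℂ] H := 1 - (c : ℂ) • (adjoint T * T) with hXdef
  have hT' := hN.blockNorm_adjoint_ne_top hT
  have hX : N (blockNorm J X) ≠ ∞ := by
    rw [hXdef, sub_eq_add_neg, ← neg_smul]
    exact hN.blockNorm_add_ne_top (hN.blockNorm_one_ne_top hJ)
      (hN.blockNorm_smul_ne_top _ (hN.blockNorm_mul_ne_top hJ hT' hT))
  have hY : N (blockNorm J (∑' n : ℕ, X ^ n)) ≠ ∞ :=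
    ne_top_of_le_ne_top (hN.tsum_blockNorm_pow_ne_top hJ hX hc)
      ((hN.mono _ _ (blockNorm_tsum_le (summable_geometric_of_norm_lt_one hc))).trans
        (hN.tsum_le _))
  have hinv : (∑' n : ℕ, X ^ n) * ((c : ℂ) • (adjoint T * T)) = 1 := by
    have := geom_series_mul_neg X hc
    rwa [hXdef, sub_sub_cancel] at this
  have hS : S = (∑' n : ℕ, X ^ n) * ((c : ℂ) • adjoint T) := by
    calc S = (∑' n : ℕ, X ^ n) * ((c : ℂ) • (adjoint T * T)) * S := by rw [hinv, one_mul]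
      _ = (∑' n : ℕ, X ^ n) * ((c : ℂ) • (adjoint T * (T * S))) := by
        rw [mul_assoc, smul_mul_assoc, mul_assoc]
      _ = _ := by rw [hTS, mul_one]
  rw [hS]
  exact hN.blockNorm_mul_ne_top hJ hY (hN.blockNorm_smul_ne_top _ hT')

end IsDifferentialNorm

end Blocks

section SequenceSpaces

open ContinuousLinearMap

variable {I K P : Type*}

/-- The restriction operator `c ↦ c ∘ f` on `ℓ²` along an injective map `f`. -/
def restrictL2 (f : K → P) (hf : Function.Injective f) : L2 P →L[ℂ] L2 K :=
  LinearMap.mkContinuous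
    { toFun := fun c => ⟨fun k => c (f k),
        memℓp_gen (((memℓp_gen_iff (by norm_num)).1 (lp.memℓp c)).comp_injective hf)⟩
      map_add' := fun _ _ => rfl
      map_smul' := fun _ _ => rfl } 1 fun c => by
    rw [one_mul]
    refine lp.norm_le_of_tsum_le (by norm_num) (norm_nonneg c) ?_
    rw [lp.norm_rpow_eq_tsum (by norm_num) c]
    exact tsum_comp_le_tsum_of_inj ((memℓp_gen_iff (by norm_num)).1 (lp.memℓp c))
      (fun _ => by positivity) hf

lemma restrictL2_apply (f : K → P) (hf : Function.Injective f) (c : L2 P) (k : K) :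
    restrictL2 f hf c k = c (f k) := rfl

lemma norm_restrictL2_le (f : K → P) (hf : Function.Injective f) : ‖restrictL2 f hf‖ ≤ 1 :=
  LinearMap.mkContinuous_norm_le _ zero_le_one _

/-- Extension by zero of `ℓ²` sequences along an injective map. -/
def extendL2 (f : K → P) (hf : Function.Injective f) : L2 K →L[ℂ] L2 P :=
  adjoint (restrictL2 f hf)

lemma adjoint_extendL2 (f : K → P) (hf : Function.Injective f) :
    adjoint (extendL2 f hf) = restrictL2 f hf := adjoint_adjoint _

lemma eval_eq_inner_single [DecidableEq P] (c : L2 P) (p : P) :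
    c p = inner ℂ (lp.single 2 p (1 : ℂ) : L2 P) c := by
  rw [lp.inner_single_left]; simp

lemma extendL2_apply_of_mem (f : K → P) (hf : Function.Injective f) (c : L2 K) (k : K) :
    extendL2 f hf c (f k) = c k := by
  classical
  rw [eval_eq_inner_single, extendL2, adjoint_inner_right, eval_eq_inner_single c k]
  congr 1
  ext l
  simp [restrictL2_apply, lp.single_apply, Pi.single_apply, hf.eq_iff]

lemma extendL2_apply_of_notMem (f : K → P) (hf : Function.Injective f) (c : L2 K) {p : P}
    (hp : p ∉ Set.range f) : extendL2 f hf c p = 0 := by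
  classical
  rw [eval_eq_inner_single, extendL2, adjoint_inner_right]
  convert inner_zero_left c
  ext l
  simp only [restrictL2_apply, lp.single_apply]
  exact Pi.single_eq_of_ne (M := fun _ : P => ℂ) (fun h => hp ⟨l, h⟩) _

lemma extendL2_single [DecidableEq K] [DecidableEq P] (f : K → P) (hf : Function.Injective f)
    (k : K) (z : ℂ) : extendL2 f hf (lp.single 2 k z) = lp.single 2 (f k) z := by
  ext p
  by_cases hp : p ∈ Set.range f
  · obtain ⟨l, rfl⟩ := hp
    rw [extendL2_apply_of_mem]
    simp [lp.single_apply, Pi.single_apply, hf.eq_iff]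
  · rw [extendL2_apply_of_notMem _ _ _ hp, lp.single_apply]
    exact (Pi.single_eq_of_ne (M := fun _ : P => ℂ) (fun h => hp ⟨k, h.symm⟩) _).symm

lemma injective_equiv_mk (e : I × K ≃ P) (i : I) : Function.Injective fun k => e (i, k) :=
  e.injective.comp (Prod.mk_right_injective i)

/-- The embedding of `ℓ²(K)` as the `i`-th block of `ℓ²(P)`, where `P ≃ I × K`. -/
def blockEmbedding (e : I × K ≃ P) (i : I) : L2 K →L[ℂ] L2 P :=
  extendL2 (fun k => e (i, k)) (injective_equiv_mk e i)

lemma isBlockDecomposition_blockEmbedding (e : I × K ≃ P) :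
    IsBlockDecomposition (blockEmbedding e) where
  norm_le i := by
    rw [blockEmbedding, extendL2, LinearIsometryEquiv.norm_map]
    exact norm_restrictL2_le _ _
  orthogonal i j hij := by
    ext c k
    rw [blockEmbedding, blockEmbedding, adjoint_extendL2, comp_apply, restrictL2_apply,
      extendL2_apply_of_notMem]
    · rfl
    · rintro ⟨l, hl⟩
      exact hij (congrArg Prod.fst (e.injective hl)).symm
  hasSum x := by
    classical
    have h1 : HasSum (fun q : I × K => (lp.single 2 (e q) (x (e q)) : L2 P)) x :=
      e.hasSum_iff.2 (lp.hasSum_single ENNReal.ofNat_ne_top x)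
    refine h1.prod_fiberwise fun i => ?_
    have h2 := (lp.hasSum_single (p := 2) ENNReal.ofNat_ne_top
      (adjoint (blockEmbedding e i) x)).mapL (blockEmbedding e i)
    simpa only [blockEmbedding, extendL2_single, adjoint_extendL2, restrictL2_apply] using h2

lemma Represents.unique {M : I → I → ℂ} {T T' : L2 I →L[ℂ] L2 I} (h : Represents M T)
    (h' : Represents M T') : T = T' := by
  ext c k
  exact (h c k).unique (h' c k)

lemma opNorm2_eq {M : I → I → ℂ} {T : L2 I →L[ℂ] L2 I} (h : Represents M T) :
    opNorm2 M = ‖T‖ := by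
  have hM : Bounded2 M := ⟨T, h⟩
  rw [opNorm2, dif_pos hM, Represents.unique hM.choose_spec h]

lemma represents_entries [DecidableEq P] (T : L2 P →L[ℂ] L2 P) :
    Represents (fun p q => T (lp.single 2 q (1 : ℂ)) p) T := by
  intro c p
  have h := ((lp.hasSum_single (p := 2) ENNReal.ofNat_ne_top c).mapL T).mapL
    (lp.evalCLM ℂ (fun _ : P => ℂ) 2 p)
  have hq : (fun q => T (lp.single 2 q (1 : ℂ)) p * c q) =
      fun q => T (lp.single 2 q (c q)) p := by
    funext q
    have : (lp.single 2 q (c q) : L2 P) = c q • lp.single 2 q (1 : ℂ) := by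
      rw [← lp.single_smul, smul_eq_mul, mul_one]
    rw [this, map_smul, mul_comm]
    rfl
  beta_reduce
  rw [hq]
  exact h

lemma Represents.block {M : P → P → ℂ} {T : L2 P →L[ℂ] L2 P} (h : Represents M T)
    (e : I × K ≃ P) (i j : I) : Represents (fun k l => M (e (i, k)) (e (j, l)))
      (adjoint (blockEmbedding e i) ∘L T ∘L blockEmbedding e j) := by
  intro c k
  have h1 := h (blockEmbedding e j c) (e (i, k))
  rw [← (injective_equiv_mk e j).hasSum_iff] at h1
  · simp only [blockEmbedding, adjoint_extendL2, comp_apply, restrictL2_apply]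
    convert h1 using 2 with l
    · simp only [Function.comp, blockEmbedding]
      rw [extendL2_apply_of_mem (fun k => e (j, k))]
    · rfl
  · intro p hp
    rw [blockEmbedding, extendL2_apply_of_notMem _ _ _ hp, mul_zero]

lemma blockNorm_blockEmbedding {M : P → P → ℂ} {T : L2 P →L[ℂ] L2 P} (h : Represents M T)
    (e : I × K ≃ P) (i j : I) : blockNorm (blockEmbedding e) T i j
      = ENNReal.ofReal (opNorm2 fun k l => M (e (i, k)) (e (j, l))) := by
  rw [opNorm2_eq (h.block e i j), blockNorm, ofReal_norm]

lemma opNorm2_nonneg (M : I → I → ℂ) : 0 ≤ opNorm2 M := by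
  unfold opNorm2
  split_ifs
  · exact norm_nonneg _
  · exact le_rfl

end SequenceSpaces

section Conversion

variable {d : ℕ} {I : Set (EuclideanSpace ℝ (Fin d))}

lemma mem_jaffardSet_iff (s : ℝ) (A : I → I → ℂ) :
    A ∈ JaffardSet I s ↔ jaffardNorm (polyWeight I s) (fun i j => ‖A i j‖ₑ) ≠ ∞ := by
  have hpt : ∀ i j : I, ‖A i j‖ₑ * polyWeight I s i j = ENNReal.ofReal
      (‖A i j‖ * (1 + ‖(i : EuclideanSpace ℝ (Fin d)) - j‖) ^ s) := fun i j => by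
    rw [polyWeight, ← ofReal_norm, ENNReal.ofReal_mul (norm_nonneg _)]
  constructor
  · rintro ⟨C, hC⟩
    refine ne_top_of_le_ne_top (ENNReal.ofReal_ne_top (r := C)) (iSup₂_le fun i j => ?_)
    rw [hpt]
    exact ENNReal.ofReal_le_ofReal (hC i j)
  · intro h
    refine ⟨(jaffardNorm (polyWeight I s) fun i j => ‖A i j‖ₑ).toReal, fun i j => ?_⟩
    rw [← ENNReal.ofReal_le_iff_le_toReal h, ← hpt]
    exact le_jaffardNorm (polyWeight I s) (fun i j => ‖A i j‖ₑ) i j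

lemma mem_schurSet_iff (δ : ℝ) (A : I → I → ℂ) :
    A ∈ SchurSet I δ ↔ schurNorm (polyWeight I δ) (fun i j => ‖A i j‖ₑ) ≠ ∞ := by
  set f : I → I → ℝ := fun i j =>
    ‖A i j‖ * (1 + ‖(i : EuclideanSpace ℝ (Fin d)) - j‖) ^ δ with hf
  have hf0 : ∀ i j, 0 ≤ f i j := fun i j => by positivity
  have hpt : ∀ i j : I, ‖A i j‖ₑ * polyWeight I δ i j = ENNReal.ofReal (f i j) := fun i j => by
    rw [polyWeight, ← ofReal_norm, ENNReal.ofReal_mul (norm_nonneg _)]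
  constructor
  · rintro ⟨h1, h2, C, hC1, hC2⟩
    refine ne_top_of_le_ne_top (ENNReal.ofReal_ne_top (r := C))
      (schurNorm_le (fun i => ?_) (fun j => ?_)) <;> simp_rw [hpt]
    · rw [← ENNReal.ofReal_tsum_of_nonneg (hf0 i) (h1 i)]
      exact ENNReal.ofReal_le_ofReal (hC1 i)
    · rw [← ENNReal.ofReal_tsum_of_nonneg (fun i => hf0 i j) (h2 j)]
      exact ENNReal.ofReal_le_ofReal (hC2 j)
  · intro h
    have hrow := row_le_schurNorm (polyWeight I δ) (fun i j => ‖A i j‖ₑ)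
    have hcol := col_le_schurNorm (polyWeight I δ) (fun i j => ‖A i j‖ₑ)
    simp_rw [hpt] at hrow hcol
    have h1 : ∀ i, Summable (f i) := fun i =>
      by simpa only [ENNReal.toReal_ofReal (hf0 i _)] using
        ENNReal.summable_toReal (ne_top_of_le_ne_top h (hrow i))
    have h2 : ∀ j, Summable fun i => f i j := fun j =>
      by simpa only [ENNReal.toReal_ofReal (hf0 _ j)] using
        ENNReal.summable_toReal (ne_top_of_le_ne_top h (hcol j))
    refine ⟨h1, h2, (schurNorm (polyWeight I δ) fun i j => ‖A i j‖ₑ).toReal,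
      fun i => ?_, fun j => ?_⟩
    · rw [← ENNReal.ofReal_le_iff_le_toReal h, ENNReal.ofReal_tsum_of_nonneg (hf0 i) (h1 i)]
      exact hrow i
    · rw [← ENNReal.ofReal_le_iff_le_toReal h,
        ENNReal.ofReal_tsum_of_nonneg (fun i => hf0 i j) (h2 j)]
      exact hcol j

end Conversion

section Tensors

variable {J₁ J₂ : Type*}

lemma represents_toMatrix_entryTensor (T : L2 (J₁ × J₂) →L[ℂ] L2 (J₁ × J₂)) :
    Represents (toMatrix (entryTensor T)) T :=
  letI : DecidableEq (J₁ × J₂) := Classical.decEq _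
  represents_entries T

/-- Membership in `Ã₁` in terms of block norms of the operator of a tensor. -/
lemma memT1_iff {S : Set (J₁ → J₁ → ℂ)} {N : (J₁ → J₁ → ℝ≥0∞) → ℝ≥0∞}
    (hS : ∀ M, M ∈ S ↔ N (fun i j => ‖M i j‖ₑ) ≠ ∞) {A : Tensor J₁ J₂}
    {T : L2 (J₁ × J₂) →L[ℂ] L2 (J₁ × J₂)} (h : Represents (toMatrix A) T) :
    MemT1 S A ↔ N (blockNorm (blockEmbedding (Equiv.refl (J₁ × J₂))) T) ≠ ∞ := by
  have hb : blockNorm (blockEmbedding (Equiv.refl (J₁ × J₂))) T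
      = fun i j => ‖(opNorm2 (res1 A i j) : ℂ)‖ₑ := by
    ext i j
    rw [blockNorm_blockEmbedding h, ← ofReal_norm, Complex.norm_of_nonneg (opNorm2_nonneg _)]
    rfl
  rw [MemT1, hS, hb]
  exact and_iff_right fun i j => ⟨_, h.block (Equiv.refl (J₁ × J₂)) i j⟩

/-- Membership in `Ã₂` in terms of block norms of the operator of a tensor. -/
lemma memT2_iff {S : Set (J₂ → J₂ → ℂ)} {N : (J₂ → J₂ → ℝ≥0∞) → ℝ≥0∞}
    (hS : ∀ M, M ∈ S ↔ N (fun i j => ‖M i j‖ₑ) ≠ ∞) {A : Tensor J₁ J₂}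
    {T : L2 (J₁ × J₂) →L[ℂ] L2 (J₁ × J₂)} (h : Represents (toMatrix A) T) :
    MemT2 S A ↔ N (blockNorm (blockEmbedding (Equiv.prodComm J₂ J₁)) T) ≠ ∞ := by
  have hb : blockNorm (blockEmbedding (Equiv.prodComm J₂ J₁)) T
      = fun k l => ‖(opNorm2 (res2 A k l) : ℂ)‖ₑ := by
    ext k l
    rw [blockNorm_blockEmbedding h, ← ofReal_norm, Complex.norm_of_nonneg (opNorm2_nonneg _)]
    rfl
  rw [MemT2, hS, hb]
  exact and_iff_right fun k l => ⟨_, h.block (Equiv.prodComm J₂ J₁) k l⟩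

end Tensors

/-- the mixed tensor algebra built from a Jaffard algebra and a weighted Schur
algebra is inverse-closed. -/
theorem statement3 {d : ℕ} (hd : 1 ≤ d)
    (I₁ I₂ : Set (EuclideanSpace ℝ (Fin d)))
    (hI₁ : RelSeparated I₁) (hI₂ : RelSeparated I₂)
    (s δ : ℝ) (hs : (d : ℝ) < s) (hδ : δ ∈ Set.Ioc (0 : ℝ) 1) :
    InverseClosed {A : Tensor ↥I₁ ↥I₂ |
      MemT1 (JaffardSet I₁ s) A ∧ MemT2 (SchurSet I₂ δ) A} := by
  rintro A ⟨hA₁, hA₂⟩ T Tinv hT hTS hST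
  have hinv := represents_toMatrix_entryTensor Tinv
  have hN₁ := hI₁.isDifferentialNorm_jaffardNorm hs
  have hN₂ := hI₂.isDifferentialNorm_schurNorm hδ.1
  rw [memT1_iff (mem_jaffardSet_iff s) hT] at hA₁
  rw [memT2_iff (mem_schurSet_iff δ) hT] at hA₂
  exact ⟨(memT1_iff (mem_jaffardSet_iff s) hinv).2
      (hN₁.blockNorm_inverse_ne_top (isBlockDecomposition_blockEmbedding _) hTS hST hA₁),
    (memT2_iff (mem_schurSet_iff δ) hinv).2
      (hN₂.blockNorm_inverse_ne_top (isBlockDecomposition_blockEmbedding _) hTS hST hA₂)⟩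

end PaperTensor
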